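/- (Lemma on contractions, part (ii): mean-field function Lipschitz bound.) Assume the adaptive ABC setting with each Q_θ admitting a density bounded by C_Q uniformly in θ, and let 𝖡 ⊂ ℝ be compact with inf_{β∈𝖡} c_β > 0. Fix α* ∈ (0,1) and define Ĥ_β(θ,θ') = α* − α̇(θ,θ') L_β(θ'), h(β) = π'_β(Ĥ_β) where π'_β(dθ,dθ') = c_β^{-1} pr(θ) L_β(θ) q(θ,θ') dθ dθ', and H̄_β = Ĥ_β − h(β). Then there exists a constant C > 0 such that for all β₁, β₂ ∈ 𝖡, sup_{(θ,θ')} |H̄_{β₁}(θ,θ') − H̄_{β₂}(θ,θ')| ≤ C |e^{β₁} − e^{β₂}|. -/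

import Mathlib

open MeasureTheory ProbabilityTheory
open scoped ENNReal

noncomputable section

namespace Adapt

variable {E : Type*} [MeasureSpace E]

/-- `L_β(θ) = Q_θ([0, e^β])`. -/
def Lb (Q : E → Measure ℝ) (β : ℝ) (θ : E) : ℝ :=
  (Q θ (Set.Icc 0 (Real.exp β))).toReal

/-- `c_β = ∫ pr(θ) L_β(θ) dθ`. -/
def cb (pr : E → ℝ) (Q : E → Measure ℝ) (β : ℝ) : ℝ :=
  ∫ θ, pr θ * Lb Q β θ

/-- `α̇(θ,ϑ) = min{1, pr(ϑ)q(ϑ,θ)/(pr(θ)q(θ,ϑ))}`. -/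
def alphadot (pr : E → ℝ) (q : E → E → ℝ) (θ ϑ : E) : ℝ :=
  min 1 (pr ϑ * q ϑ θ / (pr θ * q θ ϑ))

end Adapt

open Adapt

/-- `π'_β(g) = c_β⁻¹ ∫∫ pr(θ) L_β(θ) q(θ,θ') g(θ,θ') dθ' dθ`. -/
noncomputable def piPrime {E : Type*} [MeasureSpace E]
    (pr : E → ℝ) (q : E → E → ℝ) (Q : E → Measure ℝ) (β : ℝ)
    (g : E × E → ℝ) : ℝ :=
  (cb pr Q β)⁻¹ * ∫ θ, ∫ ϑ, pr θ * Lb Q β θ * q θ ϑ * g (θ, ϑ)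

/-- `Ĥ_β(θ,θ') = α* - α̇(θ,θ') L_β(θ')`. -/
noncomputable def Hhat {E : Type*} [MeasureSpace E]
    (pr : E → ℝ) (q : E → E → ℝ) (Q : E → Measure ℝ) (αstar β : ℝ)
    (z : E × E) : ℝ :=
  αstar - alphadot pr q z.1 z.2 * Lb Q β z.2

/-- `H̄_β = Ĥ_β - h(β)` with `h(β) = π'_β(Ĥ_β)`. -/
noncomputable def Hbar {E : Type*} [MeasureSpace E]
    (pr : E → ℝ) (q : E → E → ℝ) (Q : E → Measure ℝ) (αstar β : ℝ)
    (z : E × E) : ℝ :=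
  Hhat pr q Q αstar β z - piPrime pr q Q β (Hhat pr q Q αstar β)

theorem abs_integral_mul_le {X : Type*} [MeasurableSpace X] {μ : Measure X} {w g : X → ℝ} {K : ℝ}
    (hw : ∀ x, 0 ≤ w x) (hw1 : ∫ x, w x ∂μ = 1) (hg : ∀ x, |g x| ≤ K) :
    |∫ x, w x * g x ∂μ| ≤ K := by
  have hwi : Integrable w μ := Integrable.of_integral_ne_zero (by simp [hw1])
  have h := norm_integral_le_of_norm_le (f := fun x => w x * g x) (hwi.mul_const K)
    (Filter.Eventually.of_forall fun x => by
      rw [norm_mul, Real.norm_eq_abs, Real.norm_eq_abs, abs_of_nonneg (hw x)]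
      exact mul_le_mul_of_nonneg_left (hg x) (hw x))
  rwa [integral_mul_const, hw1, one_mul] at h

theorem integrable_mul_of_abs_le {X : Type*} [MeasurableSpace X] {μ : Measure X} {w g : X → ℝ}
    {K : ℝ} (hw : Integrable w μ) (hgm : Measurable g) (hg : ∀ x, |g x| ≤ K) :
    Integrable (fun x => w x * g x) μ :=
  hw.mul_bdd (c := K) hgm.aestronglyMeasurable (Filter.Eventually.of_forall hg)

theorem abs_integral_mul_sub_le {X : Type*} [MeasurableSpace X] {μ : Measure X} {w f g : X → ℝ}
    {K : ℝ} (hw : ∀ x, 0 ≤ w x) (hw1 : ∫ x, w x ∂μ = 1) (hfm : Measurable f) (hgm : Measurable g)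
    (hf : ∀ x, |f x| ≤ 1) (hg : ∀ x, |g x| ≤ 1) (hfg : ∀ x, |f x - g x| ≤ K) :
    |∫ x, w x * f x ∂μ - ∫ x, w x * g x ∂μ| ≤ K := by
  have hwi : Integrable w μ := Integrable.of_integral_ne_zero (by simp [hw1])
  rw [← integral_sub (integrable_mul_of_abs_le hwi hfm hf) (integrable_mul_of_abs_le hwi hgm hg)]
  simp only [← mul_sub]
  exact abs_integral_mul_le hw hw1 hfg

theorem withDensity_Icc_exp_sub_le {f : ℝ → ℝ} {C : ℝ} (hC : 0 ≤ C) (hf : ∀ t, f t ≤ C)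
    (ν : Measure ℝ) [IsFiniteMeasure ν]
    (hν : ν = volume.withDensity (fun t => ENNReal.ofReal (f t))) {a b : ℝ} (hab : a ≤ b) :
    (ν (Set.Icc 0 b)).toReal - (ν (Set.Icc 0 a)).toReal ≤ C * (b - a) := by
  have h1 : ν (Set.Icc 0 b) ≤ ν (Set.Icc 0 a) + ν (Set.Icc a b) := by
    refine (measure_mono fun x hx => ?_).trans (measure_union_le _ _)
    rcases le_total x a with h | h
    · exact Or.inl ⟨hx.1, h⟩
    · exact Or.inr ⟨h, hx.2⟩
  have h2 : ν (Set.Icc a b) ≤ ENNReal.ofReal (C * (b - a)) := by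
    rw [hν, withDensity_apply _ measurableSet_Icc, ENNReal.ofReal_mul hC, ← Real.volume_Icc,
      ← setLIntegral_const]
    exact lintegral_mono fun t => ENNReal.ofReal_le_ofReal (hf t)
  have h3 : (ν (Set.Icc a b)).toReal ≤ C * (b - a) :=
    ENNReal.toReal_le_of_le_ofReal (mul_nonneg hC (sub_nonneg.2 hab)) h2
  have h4 := ENNReal.toReal_mono (by finiteness) h1
  rw [ENNReal.toReal_add (by finiteness) (by finiteness)] at h4
  linarith

theorem abs_Lb_sub_le {E : Type*} [MeasureSpace E] {Q : E → Measure ℝ} {θ : E}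
    [IsProbabilityMeasure (Q θ)] {f : ℝ → ℝ} {C : ℝ} (hC : 0 ≤ C) (hf : ∀ t, f t ≤ C)
    (hQ : Q θ = volume.withDensity (fun t => ENNReal.ofReal (f t))) (β₁ β₂ : ℝ) :
    |Lb Q β₁ θ - Lb Q β₂ θ| ≤ C * |Real.exp β₁ - Real.exp β₂| := by
  wlog h : β₁ ≤ β₂ generalizing β₁ β₂
  · rw [abs_sub_comm, abs_sub_comm (Real.exp β₁)]
    exact this β₂ β₁ (le_of_not_ge h)
  have he := Real.exp_le_exp.2 h
  have hmono : Lb Q β₁ θ ≤ Lb Q β₂ θ :=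
    ENNReal.toReal_mono (measure_ne_top _ _) (measure_mono (Set.Icc_subset_Icc_right he))
  rw [abs_sub_comm, abs_sub_comm (Real.exp β₁), abs_of_nonneg (sub_nonneg.2 hmono),
    abs_of_nonneg (sub_nonneg.2 he)]
  exact withDensity_Icc_exp_sub_le hC hf (Q θ) hQ he

theorem Lb_mem_Icc {E : Type*} [MeasureSpace E] {Q : E → Measure ℝ} {θ : E}
    [IsProbabilityMeasure (Q θ)] (β : ℝ) : Lb Q β θ ∈ Set.Icc (0 : ℝ) 1 :=
  ⟨ENNReal.toReal_nonneg, measureReal_le_one⟩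

theorem measurable_Lb {E : Type*} [MeasureSpace E] {Q : E → Measure ℝ} (hQ : Measurable Q)
    (β : ℝ) : Measurable (Lb Q β) :=
  ((Measure.measurable_coe measurableSet_Icc).comp hQ).ennreal_toReal

theorem alphadot_mem_Icc {E : Type*} [MeasureSpace E] {pr : E → ℝ} {q : E → E → ℝ}
    (hpr : ∀ θ, 0 ≤ pr θ) (hq : ∀ θ ϑ, 0 ≤ q θ ϑ) (θ ϑ : E) :
    alphadot pr q θ ϑ ∈ Set.Icc (0 : ℝ) 1 :=
  ⟨le_min zero_le_one (div_nonneg (mul_nonneg (hpr _) (hq _ _)) (mul_nonneg (hpr _) (hq _ _))),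
    min_le_left _ _⟩

theorem measurable_Hhat {E : Type*} [MeasureSpace E] {pr : E → ℝ} {q : E → E → ℝ}
    {Q : E → Measure ℝ} (hpr : Measurable pr) (hq : Measurable (fun z : E × E => q z.1 z.2))
    (hQ : Measurable Q) (αstar β : ℝ) : Measurable (Hhat pr q Q αstar β) := by
  have hq' : Measurable (fun z : E × E => q z.2 z.1) := hq.comp measurable_swap
  have hL : Measurable (fun z : E × E => Lb Q β z.2) := (measurable_Lb hQ β).comp measurable_snd
  have h1 : Measurable (fun z : E × E => pr z.1) := hpr.comp measurable_fst
  have h2 : Measurable (fun z : E × E => pr z.2) := hpr.comp measurable_snd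
  exact measurable_const.sub ((measurable_const.min ((h2.mul hq').div (h1.mul hq))).mul hL)

theorem abs_Hhat_le_one {E : Type*} [MeasureSpace E] {pr : E → ℝ} {q : E → E → ℝ}
    {Q : E → Measure ℝ} (hpr : ∀ θ, 0 ≤ pr θ) (hq : ∀ θ ϑ, 0 ≤ q θ ϑ)
    (hQ : ∀ θ, IsProbabilityMeasure (Q θ)) {αstar : ℝ} (hα : αstar ∈ Set.Ioo (0 : ℝ) 1)
    (β : ℝ) (z : E × E) : |Hhat pr q Q αstar β z| ≤ 1 := by
  have := hQ z.2
  obtain ⟨a0, a1⟩ := alphadot_mem_Icc hpr hq z.1 z.2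
  obtain ⟨l0, l1⟩ := Lb_mem_Icc (Q := Q) (θ := z.2) β
  have h0 := mul_nonneg a0 l0
  have h1 := mul_le_one₀ a1 l0 l1
  unfold Hhat
  exact abs_le.2 ⟨by linarith [hα.1], by linarith [hα.2]⟩

theorem abs_Hhat_sub_le {E : Type*} [MeasureSpace E] {pr : E → ℝ} {q : E → E → ℝ}
    {Q : E → Measure ℝ} (hpr : ∀ θ, 0 ≤ pr θ) (hq : ∀ θ ϑ, 0 ≤ q θ ϑ) (αstar β₁ β₂ : ℝ)
    (z : E × E) :
    |Hhat pr q Q αstar β₁ z - Hhat pr q Q αstar β₂ z| ≤ |Lb Q β₁ z.2 - Lb Q β₂ z.2| := by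
  obtain ⟨a0, a1⟩ := alphadot_mem_Icc hpr hq z.1 z.2
  have h : Hhat pr q Q αstar β₁ z - Hhat pr q Q αstar β₂ z
      = -(alphadot pr q z.1 z.2 * (Lb Q β₁ z.2 - Lb Q β₂ z.2)) := by
    unfold Hhat; ring
  rw [h, abs_neg, abs_mul, abs_of_nonneg a0]
  exact mul_le_of_le_one_left (abs_nonneg _) a1

theorem abs_mul_sub_mul_le {a b x y D : ℝ} (ha : |a| ≤ 1) (hy : |y| ≤ 1)
    (hab : |a - b| ≤ D) (hxy : |x - y| ≤ D) : |a * x - b * y| ≤ 2 * D := by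
  have h : a * x - b * y = a * (x - y) + (a - b) * y := by ring
  rw [h]
  refine (abs_add_le _ _).trans ?_
  rw [abs_mul, abs_mul]
  have h1 := mul_le_of_le_one_left (abs_nonneg (x - y)) ha
  have h2 := mul_le_of_le_one_right (abs_nonneg (a - b)) hy
  linarith

theorem abs_inv_mul_sub_inv_mul_le {c₁ c₂ m N₁ N₂ D : ℝ} (hm : 0 < m) (h₁ : m ≤ c₁)
    (h₂ : m ≤ c₂) (hN₂ : |N₂| ≤ 1) (hc : |c₁ - c₂| ≤ D) (hN : |N₁ - N₂| ≤ 2 * D) :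
    |c₁⁻¹ * N₁ - c₂⁻¹ * N₂| ≤ (2 * m⁻¹ + m⁻¹ * m⁻¹) * D := by
  have p₁ : 0 < c₁ := hm.trans_le h₁
  have p₂ : 0 < c₂ := hm.trans_le h₂
  have i₁ : c₁⁻¹ ≤ m⁻¹ := inv_anti₀ hm h₁
  have i₂ : c₂⁻¹ ≤ m⁻¹ := inv_anti₀ hm h₂
  have h : c₁⁻¹ * N₁ - c₂⁻¹ * N₂
      = c₁⁻¹ * (N₁ - N₂) - c₁⁻¹ * c₂⁻¹ * ((c₁ - c₂) * N₂) := by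
    field_simp; ring
  have e₁ : |c₁⁻¹ * (N₁ - N₂)| ≤ m⁻¹ * (2 * D) := by
    rw [abs_mul, abs_of_pos (inv_pos.2 p₁)]
    gcongr
  have e₂ : |c₁⁻¹ * c₂⁻¹ * ((c₁ - c₂) * N₂)| ≤ m⁻¹ * m⁻¹ * (D * 1) := by
    rw [abs_mul, abs_mul (c₁ - c₂), abs_of_pos (mul_pos (inv_pos.2 p₁) (inv_pos.2 p₂))]
    have := (abs_nonneg _).trans hc
    gcongr
  rw [h]
  refine (abs_sub _ _).trans ?_
  linarith

theorem integral_prod_mul_eq_one {X Y : Type*} [MeasurableSpace X] [MeasurableSpace Y]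
    {μ : Measure X} {ν : Measure Y} [SFinite μ] [SFinite ν] {f : X → ℝ} {k : X → Y → ℝ}
    (hfm : Measurable f) (hkm : Measurable (fun z : X × Y => k z.1 z.2))
    (hf : ∀ x, 0 ≤ f x) (hk : ∀ x y, 0 ≤ k x y)
    (hf1 : ∫ x, f x ∂μ = 1) (hk1 : ∀ x, ∫ y, k x y ∂ν = 1) :
    ∫ z, f z.1 * k z.1 z.2 ∂(μ.prod ν) = 1 := by
  have hint : Integrable (fun z : X × Y => f z.1 * k z.1 z.2) (μ.prod ν) := by
    have hfst : Measurable (fun z : X × Y => f z.1) := hfm.comp measurable_fst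
    refine (integrable_prod_iff (hfst.mul hkm).aestronglyMeasurable).2
      ⟨Filter.Eventually.of_forall fun x => ?_, ?_⟩
    · exact (Integrable.of_integral_ne_zero (by simp [hk1 x])).const_mul (f x)
    · have hnorm : ∀ x y, ‖f x * k x y‖ = f x * k x y := fun x y =>
        Real.norm_of_nonneg (mul_nonneg (hf x) (hk x y))
      change Integrable (fun x => ∫ y, ‖f x * k x y‖ ∂ν) μ
      simp only [hnorm, integral_const_mul, hk1, mul_one]
      exact Integrable.of_integral_ne_zero (by simp [hf1])
  rw [integral_prod _ hint]
  simp only [integral_const_mul, hk1, mul_one, hf1]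

/-- Lemma on contractions, part (ii): mean-field function Lipschitz bound. -/
theorem stmt13 (p : ℕ) (T : Set (Fin p → ℝ)) (hT_open : IsOpen T) (hT_ne : T.Nonempty)
    (pr : (Fin p → ℝ) → ℝ) (hpr_meas : Measurable pr) (hpr_nonneg : ∀ θ, 0 ≤ pr θ)
    (hpr_prob : ∫ θ, pr θ = 1)
    (Cpr : ℝ) (hpr_bdd : ∀ θ, pr θ ≤ Cpr)
    (hpr_supp : ∀ θ, θ ∉ T → pr θ = 0)
    (q : (Fin p → ℝ) → (Fin p → ℝ) → ℝ)
    (hq_meas : Measurable (fun z : (Fin p → ℝ) × (Fin p → ℝ) => q z.1 z.2))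
    (hq_nonneg : ∀ θ ϑ, 0 ≤ q θ ϑ)
    (Cq : ℝ) (hq_bdd : ∀ θ ϑ, q θ ϑ ≤ Cq)
    (hq_prob : ∀ θ, ∫ ϑ, q θ ϑ = 1)
    (Q : (Fin p → ℝ) → Measure ℝ) (hQ_meas : Measurable Q)
    (hQ_prob : ∀ θ, IsProbabilityMeasure (Q θ))
    (hQ_supp : ∀ θ, Q θ (Set.Iio 0) = 0)
    (Qd : (Fin p → ℝ) → ℝ → ℝ) (CQ : ℝ)
    (hQd_nonneg : ∀ θ t, 0 ≤ Qd θ t) (hQd_bdd : ∀ θ t, Qd θ t ≤ CQ)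
    (hQd : ∀ θ, Q θ = volume.withDensity (fun t => ENNReal.ofReal (Qd θ t)))
    -- compact tolerance set with `inf_{β ∈ B} c_β > 0`
    (B : Set ℝ) (hB : IsCompact B)
    (cmin : ℝ) (hcmin : 0 < cmin) (hcb : ∀ β ∈ B, cmin ≤ cb pr Q β)
    -- desired acceptance rate
    (αstar : ℝ) (hαstar : αstar ∈ Set.Ioo (0 : ℝ) 1) :
    ∃ C : ℝ, 0 < C ∧
      ∀ β₁ ∈ B, ∀ β₂ ∈ B, ∀ θ θ' : Fin p → ℝ,
        |Hbar pr q Q αstar β₁ (θ, θ') - Hbar pr q Q αstar β₂ (θ, θ')|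
          ≤ C * |Real.exp β₁ - Real.exp β₂| := by
  have hCQ : 0 ≤ CQ := (hQd_nonneg 0 0).trans (hQd_bdd 0 0)
  have hm : 0 < cmin⁻¹ := inv_pos.2 hcmin
  refine ⟨(1 + (2 * cmin⁻¹ + cmin⁻¹ * cmin⁻¹)) * CQ + 1, by positivity, ?_⟩
  intro β₁ hβ₁ β₂ hβ₂ θ θ'
  set D := CQ * |Real.exp β₁ - Real.exp β₂| with hD
  have hL : ∀ θ, |Lb Q β₁ θ - Lb Q β₂ θ| ≤ D := fun θ =>
    have := hQ_prob θ
    abs_Lb_sub_le hCQ (hQd_bdd θ) (hQd θ) β₁ β₂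
  have hL1 : ∀ β θ, |Lb Q β θ| ≤ 1 := fun β θ => by
    have := hQ_prob θ
    obtain ⟨l0, l1⟩ := Lb_mem_Icc (Q := Q) (θ := θ) β
    rwa [abs_of_nonneg l0]
  have hH1 := abs_Hhat_le_one hpr_nonneg hq_nonneg hQ_prob hαstar
  have hH : ∀ z, |Hhat pr q Q αstar β₁ z - Hhat pr q Q αstar β₂ z| ≤ D := fun z =>
    (abs_Hhat_sub_le hpr_nonneg hq_nonneg αstar β₁ β₂ z).trans (hL z.2)
  have hc : |cb pr Q β₁ - cb pr Q β₂| ≤ D :=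
    abs_integral_mul_sub_le hpr_nonneg hpr_prob (measurable_Lb hQ_meas β₁)
      (measurable_Lb hQ_meas β₂) (hL1 β₁) (hL1 β₂) hL
  have hw : ∀ z : (Fin p → ℝ) × (Fin p → ℝ), 0 ≤ pr z.1 * q z.1 z.2 := fun z =>
    mul_nonneg (hpr_nonneg _) (hq_nonneg _ _)
  have hw1 := integral_prod_mul_eq_one (μ := volume) (ν := volume) hpr_meas hq_meas hpr_nonneg
    hq_nonneg hpr_prob hq_prob
  have hg1 : ∀ β (z : (Fin p → ℝ) × (Fin p → ℝ)),
      |Lb Q β z.1 * Hhat pr q Q αstar β z| ≤ 1 := fun β z => by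
    rw [abs_mul]
    exact mul_le_one₀ (hL1 β z.1) (abs_nonneg _) (hH1 β z)
  have hgm : ∀ β, Measurable fun z : (Fin p → ℝ) × (Fin p → ℝ) =>
      Lb Q β z.1 * Hhat pr q Q αstar β z := fun β =>
    ((measurable_Lb hQ_meas β).comp measurable_fst).mul
      (measurable_Hhat hpr_meas hq_meas hQ_meas αstar β)
  have hpi : ∀ β, piPrime pr q Q β (Hhat pr q Q αstar β) = (cb pr Q β)⁻¹ *
      ∫ z, pr z.1 * q z.1 z.2 * (Lb Q β z.1 * Hhat pr q Q αstar β z)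
        ∂((volume : Measure (Fin p → ℝ)).prod (volume : Measure (Fin p → ℝ))) := fun β => by
    rw [integral_prod _ (integrable_mul_of_abs_le
      (Integrable.of_integral_ne_zero (by simp [hw1])) (hgm β) (hg1 β)), piPrime]
    congr! 5
    ring
  have hh : |piPrime pr q Q β₁ (Hhat pr q Q αstar β₁) -
      piPrime pr q Q β₂ (Hhat pr q Q αstar β₂)| ≤ (2 * cmin⁻¹ + cmin⁻¹ * cmin⁻¹) * D := by
    rw [hpi, hpi]
    exact abs_inv_mul_sub_inv_mul_le hcmin (hcb β₁ hβ₁) (hcb β₂ hβ₂)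
      (abs_integral_mul_le hw hw1 (hg1 β₂)) hc
      (abs_integral_mul_sub_le hw hw1 (hgm β₁) (hgm β₂) (hg1 β₁) (hg1 β₂) fun z =>
        abs_mul_sub_mul_le (hL1 β₁ z.1) (hH1 β₂ z) (hL z.1) (hH z))
  have hsplit : Hbar pr q Q αstar β₁ (θ, θ') - Hbar pr q Q αstar β₂ (θ, θ') =
      (Hhat pr q Q αstar β₁ (θ, θ') - Hhat pr q Q αstar β₂ (θ, θ')) -
      (piPrime pr q Q β₁ (Hhat pr q Q αstar β₁) -
        piPrime pr q Q β₂ (Hhat pr q Q αstar β₂)) := by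
    unfold Hbar; ring
  rw [hsplit]
  refine (abs_sub _ _).trans ?_
  have hHz := hH (θ, θ')
  have he := abs_nonneg (Real.exp β₁ - Real.exp β₂)
  calc _ ≤ (1 + (2 * cmin⁻¹ + cmin⁻¹ * cmin⁻¹)) * D + |Real.exp β₁ - Real.exp β₂| := by
        linarith
    _ = _ := by rw [hD]; ring
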